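/- arXiv:2006.05910 — 5 statements merged into one kernel-verified Lean document; each statement's English description precedes it below -/
import Mathlib

section
/- Let Y be a d₁×d₁ real matrix, X a d×d₁ real matrix with ‖X‖_op > 0, and Z a d₁×d real matrix. Let W be the (d₁+d)×d block matrix whose top block is Y·Z and whose bottom block is I_d + X·Z. Then σ_min(W) ≥ (1/2)·min{1, σ_min(Y)/‖X‖_op}. -/
/-- The ℓ²→ℓ² operator norm of a matrix. -/
noncomputable def opNorm {𝕜 : Type*} [RCLike 𝕜] {m n : Type*} [Fintype m] [Fintype n]
    [DecidableEq n] (M : Matrix m n 𝕜) : ℝ :=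
  ‖LinearMap.toContinuousLinearMap (Matrix.toEuclideanLin M)‖

/-- The minimal singular value `σ_min(M)`: the infimum of `‖M v‖₂` over unit vectors `v`. -/
noncomputable def sigmaMin {𝕜 : Type*} [RCLike 𝕜] {m n : Type*} [Fintype m] [Fintype n]
    [DecidableEq n] (M : Matrix m n 𝕜) : ℝ :=
  ⨅ v : {v : EuclideanSpace 𝕜 n // ‖v‖ = 1}, ‖Matrix.toEuclideanLin M v.1‖

theorem sigmaMin_nonneg {𝕜 : Type*} [RCLike 𝕜] {m n : Type*} [Fintype m] [Fintype n]
    [DecidableEq n] (M : Matrix m n 𝕜) : 0 ≤ sigmaMin M :=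
  Real.iInf_nonneg fun _ => norm_nonneg _

theorem sigmaMin_mul_norm_le {𝕜 : Type*} [RCLike 𝕜] {m n : Type*} [Fintype m] [Fintype n]
    [DecidableEq n] (M : Matrix m n 𝕜) (u : EuclideanSpace 𝕜 n) :
    sigmaMin M * ‖u‖ ≤ ‖Matrix.toEuclideanLin M u‖ := by
  rcases eq_or_ne u 0 with rfl | hu
  · simp
  have hu' : 0 < ‖u‖ := norm_pos_iff.2 hu
  have h : sigmaMin M ≤ ‖Matrix.toEuclideanLin M ((‖u‖⁻¹ : 𝕜) • u)‖ :=
    ciInf_le (f := fun v : {v : EuclideanSpace 𝕜 n // ‖v‖ = 1} => ‖Matrix.toEuclideanLin M v.1‖)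
      ⟨0, by rintro _ ⟨v, rfl⟩; exact norm_nonneg _⟩
      ⟨(‖u‖⁻¹ : 𝕜) • u, norm_smul_inv_norm hu⟩
  rw [map_smul, norm_smul, norm_inv, RCLike.norm_ofReal, abs_norm] at h
  rwa [← le_div_iff₀ hu', div_eq_inv_mul]

theorem norm_toEuclideanLin_le {𝕜 : Type*} [RCLike 𝕜] {m n : Type*} [Fintype m] [Fintype n]
    [DecidableEq n] (M : Matrix m n 𝕜) (u : EuclideanSpace 𝕜 n) :
    ‖Matrix.toEuclideanLin M u‖ ≤ opNorm M * ‖u‖ :=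
  (LinearMap.toContinuousLinearMap (Matrix.toEuclideanLin M)).le_opNorm u

theorem norm_sq_toEuclideanLin_fromRows {𝕜 : Type*} [RCLike 𝕜] {m₁ m₂ n : Type*} [Fintype m₁]
    [Fintype m₂] [Fintype n] [DecidableEq n] (A : Matrix m₁ n 𝕜) (B : Matrix m₂ n 𝕜)
    (v : EuclideanSpace 𝕜 n) :
    ‖Matrix.toEuclideanLin (Matrix.fromRows A B) v‖ ^ 2 =
      ‖Matrix.toEuclideanLin A v‖ ^ 2 + ‖Matrix.toEuclideanLin B v‖ ^ 2 := by
  simp [EuclideanSpace.norm_sq_eq, Matrix.toLpLin_apply, Matrix.fromRows_mulVec]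

theorem nonempty_of_opNorm_pos {𝕜 : Type*} [RCLike 𝕜] {m n : Type*} [Fintype m] [Fintype n]
    [DecidableEq n] {M : Matrix m n 𝕜} (hM : 0 < opNorm M) : Nonempty m := by
  by_contra h
  rw [not_nonempty_iff] at h
  have : M = 0 := Subsingleton.elim _ _
  simp [opNorm, this] at hM

/-- For `Y : d₁×d₁`, `X : d×d₁` with `‖X‖_op > 0`, `Z : d₁×d` real matrices,
the block matrix `W = [Y·Z ; I + X·Z]` satisfies
`σ_min(W) ≥ (1/2)·min {1, σ_min(Y)/‖X‖_op}`. -/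
theorem stmt1 {d₁ d : ℕ} (Y : Matrix (Fin d₁) (Fin d₁) ℝ) (X : Matrix (Fin d) (Fin d₁) ℝ)
    (Z : Matrix (Fin d₁) (Fin d) ℝ) (hX : 0 < opNorm X) :
    (1 / 2) * min 1 (sigmaMin Y / opNorm X) ≤
      sigmaMin (Matrix.fromRows (Y * Z) ((1 : Matrix (Fin d) (Fin d) ℝ) + X * Z)) := by
  have : Nonempty (Fin d) := nonempty_of_opNorm_pos hX
  have : Nonempty {v : EuclideanSpace ℝ (Fin d) // ‖v‖ = 1} :=
    (exists_norm_eq (EuclideanSpace ℝ (Fin d)) zero_le_one).elim fun v hv => ⟨⟨v, hv⟩⟩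
  refine le_ciInf fun ⟨v, hv⟩ => ?_
  have hsq := norm_sq_toEuclideanLin_fromRows (Y * Z) (1 + X * Z) v
  set u := Matrix.toEuclideanLin Z v with hu
  have hYZ : Matrix.toEuclideanLin (Y * Z) v = Matrix.toEuclideanLin Y u := by
    simp [hu, Matrix.toLpLin_apply]
  have hXZ : Matrix.toEuclideanLin (1 + X * Z) v = v + Matrix.toEuclideanLin X u := by
    simp [hu, Matrix.toLpLin_apply]
  rw [hYZ, hXZ] at hsq
  rcases le_total ‖Matrix.toEuclideanLin X u‖ (1 / 2) with hXu | hXu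
  · have htri : ‖v‖ - ‖Matrix.toEuclideanLin X u‖ ≤ ‖v + Matrix.toEuclideanLin X u‖ :=
      norm_sub_le_norm_add _ _
    have hle : ‖v + Matrix.toEuclideanLin X u‖ ≤ ‖Matrix.toEuclideanLin
        (Matrix.fromRows (Y * Z) (1 + X * Z)) v‖ :=
      (sq_le_sq₀ (norm_nonneg _) (norm_nonneg _)).1 (by
        rw [hsq]; exact le_add_of_nonneg_left (sq_nonneg _))
    have hmin := min_le_left 1 (sigmaMin Y / opNorm X)
    linarith
  · have hu_lower : 1 / 2 / opNorm X ≤ ‖u‖ :=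
      (div_le_iff₀' hX).2 (hXu.trans (norm_toEuclideanLin_le X u))
    calc (1 / 2) * min 1 (sigmaMin Y / opNorm X)
        ≤ (1 / 2) * (sigmaMin Y / opNorm X) := by gcongr; exact min_le_right _ _
      _ = sigmaMin Y * (1 / 2 / opNorm X) := by ring
      _ ≤ sigmaMin Y * ‖u‖ := mul_le_mul_of_nonneg_left hu_lower (sigmaMin_nonneg Y)
      _ ≤ ‖Matrix.toEuclideanLin Y u‖ := sigmaMin_mul_norm_le Y u
      _ ≤ _ := (sq_le_sq₀ (norm_nonneg _) (norm_nonneg _)).1 (by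
        rw [hsq]; exact le_add_of_nonneg_right (sq_nonneg _))
end

section
/- Let A be an n×n complex matrix, B an n×q complex matrix, C a p×n complex matrix, D a p×q complex matrix, and z ∈ ℂ with spectralRadius(A) < |z|. Define G^[0] := D and G^[i] := C·A^{i−1}·B for i ≥ 1. Then the series Σ_{i=0}^∞ z^{−i}·G^[i] converges in operator norm and equals D + C·(z·I − A)^{−1}·B. -/
open Filter Topology in
/-- In a complex Banach algebra, the powers of `z⁻¹ • a` are summable as soon as the spectral
radius of `a` is less than `‖z‖`. -/
theorem summable_inv_smul_pow_of_spectralRadius_lt {R : Type*} [NormedRing R] [NormedAlgebra ℂ R]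
    [CompleteSpace R] {a : R} {z : ℂ} (h : spectralRadius ℂ a < (‖z‖₊ : ENNReal)) :
    Summable fun i : ℕ => (z⁻¹ • a) ^ i := by
  obtain ⟨r, hr, hrz⟩ := ENNReal.lt_iff_exists_nnreal_btwn.1 h
  have hrz' : (r : ℝ) < ‖z‖ := by exact_mod_cast hrz
  have hz : 0 < ‖z‖ := r.2.trans_lt hrz'
  have hbound : ∀ᶠ i : ℕ in atTop, ‖a ^ i‖ ≤ (r : ℝ) ^ i := by
    filter_upwards [(spectrum.pow_nnnorm_pow_one_div_tendsto_nhds_spectralRadius a).eventually_lt_const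
      hr, eventually_gt_atTop 0] with i hi hi0
    have hi' := ENNReal.rpow_le_rpow hi.le (Nat.cast_nonneg (α := ℝ) i)
    rw [← ENNReal.rpow_mul, one_div, inv_mul_cancel₀ (by positivity), ENNReal.rpow_one,
      ENNReal.rpow_natCast] at hi'
    exact_mod_cast hi'
  refine .of_norm_bounded_eventually_nat (g := fun i => ((r : ℝ) / ‖z‖) ^ i)
    (summable_geometric_of_lt_one (by positivity) ((div_lt_one hz).2 hrz')) ?_
  filter_upwards [hbound] with i hi
  rw [smul_pow, norm_smul, norm_pow, norm_inv, div_pow, inv_pow, div_eq_inv_mul]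
  gcongr

open scoped Matrix.Norms.L2Operator in
/-- The Neumann series of the matrix resolvent, for `z` beyond the spectral radius of `A`. -/
theorem Matrix.hasSum_inv_pow_smul_pow {n : ℕ} {A : Matrix (Fin n) (Fin n) ℂ} {z : ℂ}
    (h : spectralRadius ℂ A < (‖z‖₊ : ENNReal)) :
    HasSum (fun i : ℕ => (z ^ (i + 1))⁻¹ • A ^ i)
      (z • (1 : Matrix (Fin n) (Fin n) ℂ) - A)⁻¹ := by
  have hz : z ≠ 0 := by rintro rfl; simp at h
  have hs := summable_inv_smul_pow_of_spectralRadius_lt h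
  have hinv : (z • (1 : Matrix (Fin n) (Fin n) ℂ) - A)⁻¹ = z⁻¹ • ∑' i : ℕ, (z⁻¹ • A) ^ i := by
    refine Matrix.inv_eq_right_inv ?_
    rw [mul_smul_comm, ← smul_mul_assoc, smul_sub, inv_smul_smul₀ hz]
    exact hs.one_sub_mul_tsum_pow
  rw [hinv]
  convert! hs.hasSum.const_smul z⁻¹ using 2 with i
  rw [smul_pow, smul_smul, ← inv_pow, pow_succ']


/-- For complex matrices `A : n×n`, `B : n×q`, `C : p×n`, `D : p×q` and
`z : ℂ` with `spectralRadius(A) < |z|`, the Z-transform series `Σ_{i=0}^∞ z^{−i} • G^[i]`,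
where `G^[0] = D` and `G^[i] = C·A^{i−1}·B` for `i ≥ 1`, converges (in the matrix space,
where all norms — in particular the ℓ²→ℓ² operator norm — induce the same topology) and
equals `D + C·(z·I − A)^{−1}·B`. -/
theorem stmt3 {n p q : ℕ} (A : Matrix (Fin n) (Fin n) ℂ) (B : Matrix (Fin n) (Fin q) ℂ)
    (C : Matrix (Fin p) (Fin n) ℂ) (D : Matrix (Fin p) (Fin q) ℂ) (z : ℂ)
    (h : spectralRadius ℂ A < (‖z‖₊ : ENNReal)) :
    HasSum (fun i : ℕ => z ^ (-(i : ℤ)) • (if i = 0 then D else C * A ^ (i - 1) * B))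
      (D + C * (z • (1 : Matrix (Fin n) (Fin n) ℂ) - A)⁻¹ * B) := by
  refine (hasSum_nat_add_iff' 1).1 ?_
  have hS := ((Matrix.hasSum_inv_pow_smul_pow h).map (Matrix.addMonoidHomMulLeft C)
    (continuous_const.matrix_mul continuous_id)).map (Matrix.addMonoidHomMulRight B)
    (continuous_id.matrix_mul continuous_const)
  convert! hS using 1
  · ext1 i
    have hexp : z ^ (-((i + 1 : ℕ) : ℤ)) = (z ^ (i + 1))⁻¹ := by rw [zpow_neg, zpow_natCast]
    rw [hexp]
    simp
  · simp
end

section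
/- Let G = (G^[i])_{i≥0} be a sequence of p×q complex matrices with Σ_{i≥0} ‖G^[i]‖_op < ∞, and let u : ℕ → ℂ^q be a finitely supported sequence. Then the series Σ_{n=0}^∞ ‖(G∗u)(n)‖₂² converges and equals (1/2π)·∫₀^{2π} ‖Ǧ(e^{ιθ})·û(θ)‖₂² dθ, where û(θ) := Σ_{j≥0} e^{−ι j θ} u_j (a finite sum) and ι is the imaginary unit. -/
/-- The convolution `(G ∗ u)(k) = Σ_{i=0}^{k} G^[i] u_{k−i}` of a matrix sequence with a
vector sequence. -/
noncomputable def conv {𝕜 : Type*} [RCLike 𝕜] {m n : Type*} [Fintype m] [Fintype n]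
    [DecidableEq n] (G : ℕ → Matrix m n 𝕜) (u : ℕ → EuclideanSpace 𝕜 n) (k : ℕ) :
    EuclideanSpace 𝕜 m :=
  ∑ i ∈ Finset.range (k + 1), Matrix.toEuclideanLin (G i) (u (k - i))

/-- The Z-transform `Ǧ(z) = Σ_{i≥0} z^{−i} G^[i]` of a matrix sequence. -/
noncomputable def Zt {p q : Type*} [Fintype p] [Fintype q]
    (G : ℕ → Matrix p q ℂ) (z : ℂ) : Matrix p q ℂ :=
  ∑' i : ℕ, z ^ (-(i : ℤ)) • G i

/-- Orthogonality of the characters `θ ↦ e^{ikθ}` on `[0, 2π]`. -/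
lemma integral_exp_int_mul_I (k : ℤ) :
    ∫ θ in (0 : ℝ)..(2 * Real.pi), Complex.exp ((k : ℂ) * θ * Complex.I) =
      if k = 0 then (2 * Real.pi : ℂ) else 0 := by
  split_ifs with hk
  · simp [hk]
  · have hc : (k : ℂ) * Complex.I ≠ 0 := by simp [hk]
    have h := integral_exp_mul_complex (a := 0) (b := 2 * Real.pi) hc
    have h1 : Complex.exp ((k : ℂ) * Complex.I * ((2 * Real.pi : ℝ) : ℂ)) = 1 := by
      rw [← Complex.exp_int_mul_two_pi_mul_I k]
      congr 1
      push_cast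
      ring
    rw [h1] at h
    simp only [Complex.ofReal_zero, mul_zero, Complex.exp_zero, sub_self, zero_div] at h
    rw [← h]
    congr 1
    ext θ
    congr 1
    ring

lemma norm_exp_neg_nat_mul_I (n : ℕ) (θ : ℝ) :
    ‖Complex.exp (-(n : ℂ) * θ * Complex.I)‖ = 1 := by
  have := Complex.norm_exp_ofReal_mul_I (-(n : ℝ) * θ)
  push_cast at this
  exact this

section Parseval

variable {E : Type*} [NormedAddCommGroup E] [InnerProductSpace ℂ E] [CompleteSpace E]

/-- The Fourier coefficients of an absolutely convergent one-sided Fourier series. -/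
lemma integral_exp_smul_tsum {w : ℕ → E} (hw : Summable fun n => ‖w n‖) (m : ℕ) :
    ∫ θ in (0 : ℝ)..(2 * Real.pi), Complex.exp ((m : ℂ) * θ * Complex.I) •
      ∑' n : ℕ, Complex.exp (-(n : ℂ) * θ * Complex.I) • w n = (2 * Real.pi : ℂ) • w m := by
  have key : ∀ (n : ℕ) (θ : ℝ), Complex.exp ((m : ℂ) * θ * Complex.I) •
      Complex.exp (-(n : ℂ) * θ * Complex.I) • w n =
      Complex.exp ((((m : ℤ) - n : ℤ) : ℂ) * θ * Complex.I) • w n := by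
    intro n θ
    rw [smul_smul, ← Complex.exp_add]
    congr 2
    push_cast
    ring
  have hm : ∀ θ : ℝ, ‖Complex.exp ((m : ℂ) * θ * Complex.I)‖ = 1 := fun θ => by
    have := Complex.norm_exp_ofReal_mul_I ((m : ℝ) * θ)
    push_cast at this
    exact this
  have h := intervalIntegral.hasSum_integral_of_dominated_convergence (μ := MeasureTheory.volume)
    (a := 0) (b := 2 * Real.pi)
    (F := fun (n : ℕ) (θ : ℝ) => Complex.exp ((m : ℂ) * θ * Complex.I) •
      Complex.exp (-(n : ℂ) * θ * Complex.I) • w n)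
    (f := fun θ : ℝ => Complex.exp ((m : ℂ) * θ * Complex.I) •
      ∑' n : ℕ, Complex.exp (-(n : ℂ) * θ * Complex.I) • w n)
    (fun n _ => ‖w n‖)
    (fun n => (by fun_prop : Continuous _).aestronglyMeasurable)
    (fun n => .of_forall fun θ _ => by
      rw [norm_smul, norm_smul, hm, norm_exp_neg_nat_mul_I, one_mul, one_mul])
    (.of_forall fun _ _ => hw) intervalIntegrable_const
    (.of_forall fun θ _ => (Summable.hasSum (.of_norm (by
      simpa only [norm_smul, norm_exp_neg_nat_mul_I, one_mul] using hw))).const_smul _)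
  refine h.unique ?_
  simp only [key, intervalIntegral.integral_smul_const, integral_exp_int_mul_I]
  convert hasSum_ite_eq m ((2 * Real.pi : ℂ) • w m) using 2 with n
  by_cases hn : n = m
  · simp [hn]
  · have : (m : ℤ) - n ≠ 0 := by omega
    simp [hn, this]

/-- Parseval's identity for an absolutely convergent one-sided Fourier series with coefficients in
a Hilbert space. -/
lemma hasSum_norm_sq_of_summable_norm {w : ℕ → E} (hw : Summable fun n => ‖w n‖) :
    HasSum (fun n => ‖w n‖ ^ 2) ((1 / (2 * Real.pi)) * ∫ θ in (0 : ℝ)..(2 * Real.pi),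
      ‖∑' n : ℕ, Complex.exp (-(n : ℂ) * θ * Complex.I) • w n‖ ^ 2) := by
  set F : ℝ → E := fun θ => ∑' n : ℕ, Complex.exp (-(n : ℂ) * θ * Complex.I) • w n
  have hnorm : ∀ (n : ℕ) (θ : ℝ), ‖Complex.exp (-(n : ℂ) * θ * Complex.I) • w n‖ = ‖w n‖ :=
    fun n θ => by rw [norm_smul, norm_exp_neg_nat_mul_I, one_mul]
  have hsum : ∀ θ : ℝ, HasSum (fun n : ℕ => Complex.exp (-(n : ℂ) * θ * Complex.I) • w n) (F θ) :=
    fun θ => Summable.hasSum (.of_norm (by simpa only [hnorm] using hw))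
  have hFcont : Continuous F :=
    continuous_tsum (fun n => by fun_prop) hw fun n θ => (hnorm n θ).le
  have hFbd : ∀ θ, ‖F θ‖ ≤ ∑' n, ‖w n‖ := fun θ =>
    tsum_of_norm_bounded hw.hasSum fun n => (hnorm n θ).le
  have h := intervalIntegral.hasSum_integral_of_dominated_convergence (μ := MeasureTheory.volume)
    (a := 0) (b := 2 * Real.pi)
    (F := fun (n : ℕ) (θ : ℝ) => inner ℂ (F θ) (Complex.exp (-(n : ℂ) * θ * Complex.I) • w n))
    (f := fun θ : ℝ => inner ℂ (F θ) (F θ))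
    (fun n _ => (∑' n, ‖w n‖) * ‖w n‖)
    (fun n => (by fun_prop : Continuous _).aestronglyMeasurable)
    (fun n => .of_forall fun θ _ => by
      refine (norm_inner_le_norm _ _).trans ?_
      rw [hnorm]
      gcongr
      exact hFbd θ)
    (.of_forall fun _ _ => hw.mul_left _) intervalIntegrable_const
    (.of_forall fun θ _ => (innerSL ℂ (F θ)).hasSum (hsum θ))
  have hcoef : ∀ n : ℕ, ∫ θ in (0 : ℝ)..(2 * Real.pi),
      inner ℂ (F θ) (Complex.exp (-(n : ℂ) * θ * Complex.I) • w n) =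
      ((2 * Real.pi * ‖w n‖ ^ 2 : ℝ) : ℂ) := by
    intro n
    have hconj : ∀ θ : ℝ, inner ℂ (F θ) (Complex.exp (-(n : ℂ) * θ * Complex.I) • w n) =
        (starRingEnd ℂ) (innerSL ℂ (w n) (Complex.exp ((n : ℂ) * θ * Complex.I) • F θ)) := by
      intro θ
      rw [innerSL_apply_apply, inner_conj_symm, inner_smul_left, inner_smul_right,
        ← Complex.exp_conj]
      simp
    have hc : Continuous fun θ : ℝ => Complex.exp ((n : ℂ) * θ * Complex.I) • F θ := by fun_prop
    simp only [hconj]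
    rw [intervalIntegral.integral_of_le Real.two_pi_pos.le, integral_conj,
      ← intervalIntegral.integral_of_le Real.two_pi_pos.le,
      ContinuousLinearMap.intervalIntegral_comp_comm _ (hc.intervalIntegrable _ _),
      integral_exp_smul_tsum hw, innerSL_apply_apply, inner_smul_right, inner_self_eq_norm_sq_to_K]
    have h2 : (2 * Real.pi : ℂ) = ((2 * Real.pi : ℝ) : ℂ) := by push_cast; rfl
    rw [h2]
    simp only [map_mul, map_pow, Complex.coe_algebraMap, Complex.conj_ofReal]
    push_cast
    rfl
  simp only [hcoef, inner_self_eq_norm_sq_to_K] at h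
  have hre : HasSum (fun n => 2 * Real.pi * ‖w n‖ ^ 2)
      (∫ θ in (0 : ℝ)..(2 * Real.pi), ‖F θ‖ ^ 2) := by
    rw [← Complex.hasSum_ofReal]
    rw [← intervalIntegral.integral_ofReal]
    simpa only [Complex.ofReal_pow, Complex.coe_algebraMap] using h
  have hpi : 1 / (2 * Real.pi) * (2 * Real.pi) = 1 := one_div_mul_cancel Real.two_pi_pos.ne'
  simpa only [← mul_assoc, hpi, one_mul] using hre.mul_left (1 / (2 * Real.pi))

end Parseval

section Cauchy

variable {E F : Type*} [NormedAddCommGroup E] [NormedSpace ℂ E] [NormedAddCommGroup F]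
  [NormedSpace ℂ F]

lemma summable_norm_sum_antidiagonal_clm_apply {A : ℕ → E →L[ℂ] F} {v : ℕ → E}
    (hA : Summable fun i => ‖A i‖) (hv : Summable fun j => ‖v j‖) :
    Summable fun n => ‖∑ x ∈ Finset.HasAntidiagonal.antidiagonal n, A x.1 (v x.2)‖ := by
  have hAv : Summable fun x : ℕ × ℕ => ‖A x.1‖ * ‖v x.2‖ :=
    hA.mul_of_nonneg hv (fun _ => norm_nonneg _) (fun _ => norm_nonneg _)
  refine .of_nonneg_of_le (fun _ => norm_nonneg _) (fun n => ?_)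
    (summable_sum_mul_antidiagonal_of_summable_mul (f := fun i => ‖A i‖) (g := fun j => ‖v j‖) hAv)
  exact (norm_sum_le _ _).trans (Finset.sum_le_sum fun x _ => (A x.1).le_opNorm _)

/-- The Cauchy product formula for operator series applied to a vector series. -/
lemma tsum_clm_apply_tsum_eq_tsum_sum_antidiagonal [CompleteSpace F] [CompleteSpace E]
    {A : ℕ → E →L[ℂ] F} {v : ℕ → E} (hA : Summable fun i => ‖A i‖) (hv : Summable fun j => ‖v j‖) :
    (∑' i, A i) (∑' j, v j) = ∑' n, ∑ x ∈ Finset.HasAntidiagonal.antidiagonal n, A x.1 (v x.2) := by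
  have hprod : Summable fun x : ℕ × ℕ => A x.1 (v x.2) :=
    .of_norm_bounded (hA.mul_of_nonneg hv (fun _ => norm_nonneg _) (fun _ => norm_nonneg _))
      fun x => (A x.1).le_opNorm _
  have hrow : ∀ i, HasSum (fun j => A i (v j)) (A i (∑' j, v j)) := fun i =>
    (A i).hasSum hv.of_norm.hasSum
  have hcol : HasSum (fun i => A i (∑' j, v j)) ((∑' i, A i) (∑' j, v j)) :=
    (ContinuousLinearMap.apply ℂ F (∑' j, v j)).hasSum hA.of_norm.hasSum
  have heq := (hprod.hasSum.prod_fiberwise hrow).unique hcol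
  have hanti := Finset.HasAntidiagonal.sigmaAntidiagonalEquivProd.summable_iff.mpr hprod
  rw [← heq, ← Finset.HasAntidiagonal.sigmaAntidiagonalEquivProd.tsum_eq]
  refine (hanti.tsum_sigma' fun n => (hasSum_fintype _).summable).trans (tsum_congr fun n => ?_)
  rw [tsum_fintype]
  exact Finset.sum_coe_sort (Finset.HasAntidiagonal.antidiagonal n) fun x => A x.1 (v x.2)

end Cauchy

/-- The Euclidean operator of a Z-transform is the sum of the series of operators. -/
lemma toContinuousLinearMap_toEuclideanLin_Zt {p q : Type*} [Fintype p] [Fintype q]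
    [DecidableEq q] (G : ℕ → Matrix p q ℂ) {z : ℂ} (hz : ‖z‖ = 1)
    (hG : Summable fun i => opNorm (G i)) :
    LinearMap.toContinuousLinearMap (Matrix.toEuclideanLin (Zt G z)) =
      ∑' i : ℕ, z ^ (-(i : ℤ)) • LinearMap.toContinuousLinearMap (Matrix.toEuclideanLin (G i)) := by
  let e : Matrix p q ℂ ≃ₗ[ℂ] (EuclideanSpace ℂ q →L[ℂ] EuclideanSpace ℂ p) :=
    Matrix.toEuclideanLin ≪≫ₗ LinearMap.toContinuousLinearMap
  have hs : Summable fun i : ℕ => z ^ (-(i : ℤ)) • e (G i) := by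
    refine .of_norm ?_
    simp only [norm_smul, norm_zpow, hz, one_zpow, one_mul]
    exact hG
  have hc : Continuous e.symm.toLinearMap := LinearMap.continuous_of_finiteDimensional _
  have h := hs.hasSum.map e.symm.toLinearMap hc
  have hZ : Zt G z = e.symm (∑' i : ℕ, z ^ (-(i : ℤ)) • e (G i)) := by
    rw [Zt]
    refine HasSum.tsum_eq ?_
    have hi : ∀ i : ℕ, e.symm (z ^ (-(i : ℤ)) • e (G i)) = z ^ (-(i : ℤ)) • G i := fun i => by
      rw [map_smul, LinearEquiv.symm_apply_apply]
    simpa only [Function.comp_def, LinearEquiv.coe_coe, hi] using h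
  change e (Zt G z) = ∑' i : ℕ, z ^ (-(i : ℤ)) • e (G i)
  rw [hZ, LinearEquiv.apply_symm_apply]

/-- **Parseval.** If `Σ_{i≥0} ‖G^[i]‖_op < ∞` and `u` is finitely supported,
then `Σ_{n=0}^∞ ‖(G∗u)(n)‖₂²` converges and equals
`(1/2π)·∫₀^{2π} ‖Ǧ(e^{ιθ})·û(θ)‖₂² dθ` with `û(θ) = Σ_{j≥0} e^{−ιjθ} u_j`. -/
theorem stmt5 {p q : ℕ} (G : ℕ → Matrix (Fin p) (Fin q) ℂ)
    (hG : Summable fun i => opNorm (G i))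
    (u : ℕ → EuclideanSpace ℂ (Fin q)) (hu : (Function.support u).Finite) :
    HasSum (fun n : ℕ => ‖conv G u n‖ ^ 2)
      ((1 / (2 * Real.pi)) * ∫ θ in (0 : ℝ)..(2 * Real.pi),
        ‖Matrix.toEuclideanLin (Zt G (Complex.exp ((θ : ℂ) * Complex.I)))
            (∑' j : ℕ, Complex.exp (-(j : ℂ) * (θ : ℂ) * Complex.I) • u j)‖ ^ 2) := by
  set A : ℕ → EuclideanSpace ℂ (Fin q) →L[ℂ] EuclideanSpace ℂ (Fin p) :=
    fun i => LinearMap.toContinuousLinearMap (Matrix.toEuclideanLin (G i))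
  have hA : Summable fun i => ‖A i‖ := hG
  have hv : Summable fun j => ‖u j‖ :=
    summable_of_hasFiniteSupport (hu.subset fun j hj => by simpa using hj)
  have hconv : ∀ n, conv G u n = ∑ x ∈ Finset.HasAntidiagonal.antidiagonal n, A x.1 (u x.2) := fun n =>
    (Finset.Nat.sum_antidiagonal_eq_sum_range_succ (fun i j => A i (u j)) n).symm
  have hw : Summable fun n => ‖conv G u n‖ := by
    simpa only [hconv] using summable_norm_sum_antidiagonal_clm_apply hA hv
  have hF : ∀ θ : ℝ, Matrix.toEuclideanLin (Zt G (Complex.exp ((θ : ℂ) * Complex.I)))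
      (∑' j : ℕ, Complex.exp (-(j : ℂ) * (θ : ℂ) * Complex.I) • u j) =
      ∑' n : ℕ, Complex.exp (-(n : ℂ) * θ * Complex.I) • conv G u n := by
    intro θ
    have hz : ‖Complex.exp ((θ : ℂ) * Complex.I)‖ = 1 := Complex.norm_exp_ofReal_mul_I θ
    have hpow : ∀ i : ℕ, Complex.exp ((θ : ℂ) * Complex.I) ^ (-(i : ℤ)) =
        Complex.exp (-(i : ℂ) * θ * Complex.I) := fun i => by
      rw [← Complex.exp_int_mul]
      congr 1
      push_cast
      ring
    rw [← LinearMap.coe_toContinuousLinearMap',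
      toContinuousLinearMap_toEuclideanLin_Zt G hz hG]
    simp only [hpow]
    rw [tsum_clm_apply_tsum_eq_tsum_sum_antidiagonal
      (by simpa only [norm_smul, norm_exp_neg_nat_mul_I, one_mul] using hA)
      (by simpa only [norm_smul, norm_exp_neg_nat_mul_I, one_mul] using hv)]
    refine tsum_congr fun n => ?_
    rw [hconv, Finset.smul_sum]
    refine Finset.sum_congr rfl fun x hx => ?_
    rw [smul_apply, map_smul, smul_smul, ← Complex.exp_add,
      ← Finset.HasAntidiagonal.mem_antidiagonal.mp hx]
    congr 2
    push_cast
    ring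
  simpa only [hF] using hasSum_norm_sq_of_summable_norm hw
end

section
/- Let A⋆, B⋆, C⋆, K be real matrices of sizes dx×dx, dx×du, dy×dx, du×dy respectively, with K ≠ 0, and set A_K := A⋆ + B⋆·K·C⋆. Assume spectralRadius(A_K) < 1 (viewing A_K as a complex matrix), and let z ∈ ℂ with |z| = 1. Let Ǎ(z) := (z·I − A_K)^{−1} (which exists), and let M(z) be the (dy+du)×du complex block matrix whose top block is C⋆·Ǎ(z)·B⋆ and whose bottom block is I_{du} + K·C⋆·Ǎ(z)·B⋆ (all matrices viewed as complex). Then σ_min(M(z)) ≥ (1/2)·min{1, ‖K‖_op^{−1}}. -/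
theorem toEuclideanLin_norm_le_opNorm {𝕜 m n : Type*} [RCLike 𝕜] [Fintype m] [Fintype n]
    [DecidableEq n] (M : Matrix m n 𝕜) (x : EuclideanSpace 𝕜 n) :
    ‖Matrix.toEuclideanLin M x‖ ≤ opNorm M * ‖x‖ :=
  (LinearMap.toContinuousLinearMap (Matrix.toEuclideanLin M)).le_opNorm x

theorem opNorm_pos {𝕜 m n : Type*} [RCLike 𝕜] [Fintype m] [Fintype n] [DecidableEq n]
    {M : Matrix m n 𝕜} (hM : M ≠ 0) : 0 < opNorm M := by
  refine norm_pos_iff.mpr fun h => hM ?_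
  simpa using h

/-- Complexification does not increase the operator norm of a real matrix. -/
theorem toEuclideanLin_map_ofReal_norm_le {m n : Type*} [Fintype m] [Fintype n] [DecidableEq n]
    (M : Matrix m n ℝ) (x : EuclideanSpace ℂ n) :
    ‖Matrix.toEuclideanLin (M.map Complex.ofReal) x‖ ≤ opNorm M * ‖x‖ := by
  have hnn : 0 ≤ opNorm M := norm_nonneg _
  let a : EuclideanSpace ℝ n := WithLp.toLp 2 fun i => (x i).re
  let b : EuclideanSpace ℝ n := WithLp.toLp 2 fun i => (x i).im
  have hx : ‖x‖ ^ 2 = ‖a‖ ^ 2 + ‖b‖ ^ 2 := by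
    simp only [EuclideanSpace.norm_sq_eq, ← Finset.sum_add_distrib]
    refine Finset.sum_congr rfl fun i _ => ?_
    rw [Complex.sq_norm, Complex.normSq_apply]
    simp [a, b, sq]
  have hMx : ‖Matrix.toEuclideanLin (M.map Complex.ofReal) x‖ ^ 2 =
      ‖Matrix.toEuclideanLin M a‖ ^ 2 + ‖Matrix.toEuclideanLin M b‖ ^ 2 := by
    simp only [EuclideanSpace.norm_sq_eq, ← Finset.sum_add_distrib]
    refine Finset.sum_congr rfl fun i _ => ?_
    rw [Complex.sq_norm, Complex.normSq_apply]
    simp [a, b, sq, Matrix.toLpLin_apply, Matrix.mulVec,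
      dotProduct]
  have ha := pow_le_pow_left₀ (norm_nonneg _) (toEuclideanLin_norm_le_opNorm M a) 2
  have hb := pow_le_pow_left₀ (norm_nonneg _) (toEuclideanLin_norm_le_opNorm M b) 2
  refine (pow_le_pow_iff_left₀ (norm_nonneg _) (by positivity) two_ne_zero).mp ?_
  rw [mul_pow, hx, hMx]
  linarith [mul_pow (opNorm M) ‖a‖ 2, mul_pow (opNorm M) ‖b‖ 2]

theorem toEuclideanLin_fromRows_norm_sq {𝕜 m₁ m₂ n : Type*} [RCLike 𝕜] [Fintype m₁] [Fintype m₂]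
    [Fintype n] [DecidableEq n] (A : Matrix m₁ n 𝕜) (B : Matrix m₂ n 𝕜)
    (v : EuclideanSpace 𝕜 n) :
    ‖Matrix.toEuclideanLin (Matrix.fromRows A B) v‖ ^ 2 =
      ‖Matrix.toEuclideanLin A v‖ ^ 2 + ‖Matrix.toEuclideanLin B v‖ ^ 2 := by
  simp [EuclideanSpace.norm_sq_eq, Fintype.sum_sum_type, Matrix.toLpLin_apply,
    Matrix.fromRows_mulVec]

theorem half_min_one_inv_mul_one_add_le {k : ℝ} (hk : 0 < k) :
    (1 / 2) * min 1 k⁻¹ * (1 + k) ≤ 1 := by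
  have h₁ : min 1 k⁻¹ ≤ 1 := min_le_left _ _
  have h₂ : min 1 k⁻¹ * k ≤ 1 := by
    calc min 1 k⁻¹ * k ≤ k⁻¹ * k := by gcongr; exact min_le_right _ _
      _ = 1 := inv_mul_cancel₀ hk.ne'
  linarith

/-- The lower bound holds for every block matrix of the form `[Y ; I + K·Y]`. -/
theorem half_min_one_inv_opNorm_le_sigmaMin {m n : Type*} [Fintype m] [Fintype n]
    [DecidableEq m] [DecidableEq n] (K : Matrix n m ℝ) (hK : K ≠ 0) (Y : Matrix m n ℂ) :
    (1 / 2) * min 1 (opNorm K)⁻¹ ≤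
      sigmaMin (Matrix.fromRows Y (1 + K.map Complex.ofReal * Y)) := by
  have hk := opNorm_pos hK
  have : Nonempty n := by
    by_contra h
    rw [not_nonempty_iff] at h
    exact hK (Subsingleton.elim _ _)
  have : Nonempty {v : EuclideanSpace ℂ n // ‖v‖ = 1} :=
    ⟨EuclideanSpace.single (Classical.arbitrary n) 1, by simp⟩
  refine le_ciInf fun ⟨v, hv⟩ => ?_
  set B := 1 + K.map Complex.ofReal * Y
  have hsq := toEuclideanLin_fromRows_norm_sq Y B v
  set w := ‖Matrix.toEuclideanLin (Matrix.fromRows Y B) v‖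
  have hw : 0 ≤ w := norm_nonneg _
  have hY : ‖Matrix.toEuclideanLin Y v‖ ≤ w :=
    (pow_le_pow_iff_left₀ (norm_nonneg _) hw two_ne_zero).mp
      (by rw [hsq]; linarith [sq_nonneg ‖Matrix.toEuclideanLin B v‖])
  have hB : ‖Matrix.toEuclideanLin B v‖ ≤ w :=
    (pow_le_pow_iff_left₀ (norm_nonneg _) hw two_ne_zero).mp
      (by rw [hsq]; linarith [sq_nonneg ‖Matrix.toEuclideanLin Y v‖])
  have hdecomp : v = Matrix.toEuclideanLin B v -
      Matrix.toEuclideanLin (K.map Complex.ofReal) (Matrix.toEuclideanLin Y v) := by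
    ext i
    simp [B, Matrix.toLpLin_apply]
  have hone : 1 ≤ (1 + opNorm K) * w := by
    calc (1 : ℝ) = ‖v‖ := hv.symm
      _ ≤ ‖Matrix.toEuclideanLin B v‖ +
          ‖Matrix.toEuclideanLin (K.map Complex.ofReal) (Matrix.toEuclideanLin Y v)‖ := by
        conv_lhs => rw [hdecomp]
        exact norm_sub_le _ _
      _ ≤ w + opNorm K * w := by
        gcongr
        exact (toEuclideanLin_map_ofReal_norm_le K _).trans (by gcongr)
      _ = (1 + opNorm K) * w := by ring
  have hc : 0 ≤ (1 / 2) * min 1 (opNorm K)⁻¹ := by positivity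
  calc (1 / 2) * min 1 (opNorm K)⁻¹
      ≤ (1 / 2) * min 1 (opNorm K)⁻¹ * ((1 + opNorm K) * w) := le_mul_of_one_le_right hc hone
    _ = (1 / 2) * min 1 (opNorm K)⁻¹ * (1 + opNorm K) * w := by ring
    _ ≤ w := mul_le_of_le_one_left hw (half_min_one_inv_mul_one_add_le hk)

/-- Let `A⋆, B⋆, C⋆, K` be real matrices with `K ≠ 0`,
`A_K := A⋆ + B⋆·K·C⋆`, `spectralRadius(A_K) < 1`, and let `|z| = 1`. With
`Ǎ(z) = (z·I − A_K)^{−1}` and the block matrix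
`M(z) = [C⋆·Ǎ(z)·B⋆ ; I + K·C⋆·Ǎ(z)·B⋆]` (complexified), we have
`σ_min(M(z)) ≥ (1/2)·min {1, ‖K‖_op^{−1}}`. -/
theorem stmt8 {dx du dy : ℕ} (Ast : Matrix (Fin dx) (Fin dx) ℝ)
    (Bst : Matrix (Fin dx) (Fin du) ℝ) (Cst : Matrix (Fin dy) (Fin dx) ℝ)
    (K : Matrix (Fin du) (Fin dy) ℝ) (hK : K ≠ 0)
    (hA : spectralRadius ℂ ((Ast + Bst * K * Cst).map Complex.ofReal) < 1)
    (z : ℂ) (hz : ‖z‖ = 1) :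
    (1 / 2) * min 1 (opNorm K)⁻¹ ≤
      sigmaMin (Matrix.fromRows
        (Cst.map Complex.ofReal *
          (z • (1 : Matrix (Fin dx) (Fin dx) ℂ) -
            (Ast + Bst * K * Cst).map Complex.ofReal)⁻¹ * Bst.map Complex.ofReal)
        ((1 : Matrix (Fin du) (Fin du) ℂ) +
          K.map Complex.ofReal * Cst.map Complex.ofReal *
            (z • (1 : Matrix (Fin dx) (Fin dx) ℂ) -
              (Ast + Bst * K * Cst).map Complex.ofReal)⁻¹ * Bst.map Complex.ofReal)) := by
  simpa only [Matrix.mul_assoc] using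
    half_min_one_inv_opNorm_le_sigmaMin K hK (Cst.map Complex.ofReal *
      ((z • (1 : Matrix (Fin dx) (Fin dx) ℂ) -
        (Ast + Bst * K * Cst).map Complex.ofReal)⁻¹ * Bst.map Complex.ofReal))
end

section
/- Let A⋆, B⋆, C⋆, K be real matrices of sizes dx×dx, dx×du, dy×dx, du×dy respectively, with K ≠ 0, and suppose there exist c ≥ 1 and ρ ∈ (0,1) such that ‖A_K^i‖_op ≤ c·ρ^i for all i ≥ 0, where A_K := A⋆ + B⋆·K·C⋆. Define the Markov operator G_K by G_K^[0] := the (dy+du)×du block matrix with zero top block and identity I_{du} bottom block, and G_K^[i] := [C⋆; K·C⋆]·A_K^{i−1}·B⋆ for i ≥ 1, where [C⋆; K·C⋆] is the (dy+du)×dx matrix stacking C⋆ on top of K·C⋆. Then for every sequence u : ℕ → ℝ^{du} with Σ_{n≥0} ‖u_n‖₂² = 1 (the series being summable with sum 1), the series Σ_{n=0}^∞ ‖Σ_{i=0}^{n} G_K^[i] u_{n−i}‖₂² converges and its sum is at least (1/4)·min{1, ‖K‖_op^{−2}}. -/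
/-- The closed-loop Markov operator `G_K` of an LDS stabilized by static feedback `K`:
`G_K^[0] = [0; I]` and `G_K^[i] = [C⋆; K·C⋆]·A_K^{i−1}·B⋆` for `i ≥ 1`. -/
noncomputable def GK {dx du dy : ℕ} (Ast : Matrix (Fin dx) (Fin dx) ℝ)
    (Bst : Matrix (Fin dx) (Fin du) ℝ) (Cst : Matrix (Fin dy) (Fin dx) ℝ)
    (K : Matrix (Fin du) (Fin dy) ℝ) (i : ℕ) : Matrix (Fin dy ⊕ Fin du) (Fin du) ℝ :=
  if i = 0 then Matrix.fromRows 0 (1 : Matrix (Fin du) (Fin du) ℝ)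
  else
    Matrix.fromRows (Cst * (Ast + Bst * K * Cst) ^ (i - 1) * Bst)
      (K * Cst * (Ast + Bst * K * Cst) ^ (i - 1) * Bst)

theorem norm_toEuclideanLin_le_opNorm {𝕜 : Type*} [RCLike 𝕜] {m n : Type*} [Fintype m]
    [Fintype n] [DecidableEq n] (M : Matrix m n 𝕜) (x : EuclideanSpace 𝕜 n) :
    ‖Matrix.toEuclideanLin M x‖ ≤ opNorm M * ‖x‖ :=
  (LinearMap.toContinuousLinearMap (Matrix.toEuclideanLin M)).le_opNorm x

theorem opNorm_nonneg {𝕜 : Type*} [RCLike 𝕜] {m n : Type*} [Fintype m]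
    [Fintype n] [DecidableEq n] (M : Matrix m n 𝕜) : 0 ≤ opNorm M :=
  norm_nonneg _

theorem toEuclideanLin_mul_apply {𝕜 : Type*} [RCLike 𝕜] {l m n : Type*} [Fintype l] [Fintype m]
    [Fintype n] [DecidableEq m] [DecidableEq n] (M : Matrix l m 𝕜) (N : Matrix m n 𝕜)
    (x : EuclideanSpace 𝕜 n) :
    Matrix.toEuclideanLin (M * N) x = Matrix.toEuclideanLin M (Matrix.toEuclideanLin N x) := by
  simp [Matrix.toLpLin_apply, Matrix.mulVec_mulVec]

theorem toEuclideanLin_fromRows_apply {𝕜 : Type*} [RCLike 𝕜] {l m n : Type*} [Fintype l]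
    [Fintype m] [Fintype n] [DecidableEq n] (M : Matrix l n 𝕜) (N : Matrix m n 𝕜)
    (x : EuclideanSpace 𝕜 n) (i : l ⊕ m) :
    Matrix.toEuclideanLin (Matrix.fromRows M N) x i =
      Sum.elim (Matrix.toEuclideanLin M x) (Matrix.toEuclideanLin N x) i := by
  simp [Matrix.toLpLin_apply, Matrix.fromRows_mulVec]

/-- Young's inequality `ℓ¹ ∗ ℓ² ⊆ ℓ²` for geometrically decaying matrix sequences. -/
theorem summable_norm_sq_conv {𝕜 : Type*} [RCLike 𝕜] {m n : Type*} [Fintype m] [Fintype n]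
    [DecidableEq n] {G : ℕ → Matrix m n 𝕜} {M ρ : ℝ} (hρ : ρ ∈ Set.Ioo (0 : ℝ) 1)
    (hG : ∀ i x, ‖Matrix.toEuclideanLin (G i) x‖ ≤ M * ρ ^ i * ‖x‖)
    {u : ℕ → EuclideanSpace 𝕜 n} (hu : Summable fun k => ‖u k‖ ^ 2) :
    Summable fun k => ‖conv G u k‖ ^ 2 := by
  have hgeo : Summable fun i : ℕ => ρ ^ i := summable_geometric_of_lt_one hρ.1.le hρ.2
  have hprod : Summable fun k => ∑ i ∈ Finset.range (k + 1), ρ ^ i * ‖u (k - i)‖ ^ 2 :=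
    (summable_norm_sum_mul_range_of_summable_norm hgeo.norm hu.norm).of_norm
  refine Summable.of_nonneg_of_le (fun _ => sq_nonneg _) (fun k => ?_)
    (hprod.mul_left (M ^ 2 * ∑' i : ℕ, ρ ^ i))
  have hnorm : ‖conv G u k‖ ≤ M * ∑ i ∈ Finset.range (k + 1), ρ ^ i * ‖u (k - i)‖ := by
    rw [Finset.mul_sum]
    exact norm_sum_le_of_le _ fun i _ => (hG i _).trans_eq (mul_assoc _ _ _)
  have hcs : (∑ i ∈ Finset.range (k + 1), ρ ^ i * ‖u (k - i)‖) ^ 2 ≤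
      (∑ i ∈ Finset.range (k + 1), ρ ^ i) *
        ∑ i ∈ Finset.range (k + 1), ρ ^ i * ‖u (k - i)‖ ^ 2 :=
    Finset.sum_sq_le_sum_mul_sum_of_sq_le_mul _ (fun i _ => pow_nonneg hρ.1.le i)
      (fun i _ => mul_nonneg (pow_nonneg hρ.1.le i) (sq_nonneg _)) fun i _ => le_of_eq (by ring)
  have hpos : 0 ≤ ∑ i ∈ Finset.range (k + 1), ρ ^ i * ‖u (k - i)‖ ^ 2 :=
    Finset.sum_nonneg fun i _ => mul_nonneg (pow_nonneg hρ.1.le i) (sq_nonneg _)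
  calc ‖conv G u k‖ ^ 2
      ≤ (M * ∑ i ∈ Finset.range (k + 1), ρ ^ i * ‖u (k - i)‖) ^ 2 := by gcongr
    _ = M ^ 2 * (∑ i ∈ Finset.range (k + 1), ρ ^ i * ‖u (k - i)‖) ^ 2 := mul_pow _ _ _
    _ ≤ M ^ 2 * ((∑' i : ℕ, ρ ^ i) *
          ∑ i ∈ Finset.range (k + 1), ρ ^ i * ‖u (k - i)‖ ^ 2) := by
        refine mul_le_mul_of_nonneg_left (hcs.trans ?_) (sq_nonneg M)
        exact mul_le_mul_of_nonneg_right
          (hgeo.sum_le_tsum _ fun i _ => pow_nonneg hρ.1.le i) hpos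
    _ = _ := (mul_assoc _ _ _).symm

theorem GK_geometric_bound {dx du dy : ℕ} (Ast : Matrix (Fin dx) (Fin dx) ℝ)
    (Bst : Matrix (Fin dx) (Fin du) ℝ) (Cst : Matrix (Fin dy) (Fin dx) ℝ)
    (K : Matrix (Fin du) (Fin dy) ℝ) {c ρ : ℝ} (hc : 0 ≤ c) (hρ : 0 < ρ)
    (hdecay : ∀ i : ℕ, opNorm ((Ast + Bst * K * Cst) ^ i) ≤ c * ρ ^ i) :
    ∃ M : ℝ, ∀ i x, ‖Matrix.toEuclideanLin (GK Ast Bst Cst K i) x‖ ≤ M * ρ ^ i * ‖x‖ := by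
  set F := Matrix.fromRows Cst (K * Cst)
  have hF := opNorm_nonneg F
  have hB := opNorm_nonneg Bst
  have h0 := opNorm_nonneg (GK Ast Bst Cst K 0)
  refine ⟨opNorm (GK Ast Bst Cst K 0) + opNorm F * c * opNorm Bst / ρ, fun i x => ?_⟩
  rcases i with _ | i
  · refine (norm_toEuclideanLin_le_opNorm _ x).trans ?_
    gcongr
    rw [pow_zero, mul_one]
    exact le_add_of_nonneg_right (by positivity)
  · have hGK : GK Ast Bst Cst K (i + 1) = F * ((Ast + Bst * K * Cst) ^ i * Bst) := by
      simp [GK, F, Matrix.fromRows_mul, Matrix.mul_assoc]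
    rw [hGK, toEuclideanLin_mul_apply, toEuclideanLin_mul_apply]
    calc _ ≤ opNorm F * (c * ρ ^ i * (opNorm Bst * ‖x‖)) := by
          refine (norm_toEuclideanLin_le_opNorm _ _).trans (mul_le_mul_of_nonneg_left ?_ hF)
          refine (norm_toEuclideanLin_le_opNorm _ _).trans ?_
          exact mul_le_mul (hdecay i) (norm_toEuclideanLin_le_opNorm _ _) (norm_nonneg _)
            (by positivity)
      _ = opNorm F * c * opNorm Bst / ρ * ρ ^ (i + 1) * ‖x‖ := by
          field_simp
          ring
      _ ≤ _ := by
          gcongr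
          exact le_add_of_nonneg_left h0

/-- The closed-loop response splits as the output `y` stacked on `u + K y`. -/
theorem exists_norm_sq_conv_GK {dx du dy : ℕ} (Ast : Matrix (Fin dx) (Fin dx) ℝ)
    (Bst : Matrix (Fin dx) (Fin du) ℝ) (Cst : Matrix (Fin dy) (Fin dx) ℝ)
    (K : Matrix (Fin du) (Fin dy) ℝ) (u : ℕ → EuclideanSpace ℝ (Fin du)) (n : ℕ) :
    ∃ y : EuclideanSpace ℝ (Fin dy),
      ‖conv (GK Ast Bst Cst K) u n‖ ^ 2 = ‖y‖ ^ 2 + ‖u n + Matrix.toEuclideanLin K y‖ ^ 2 := by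
  obtain ⟨H, hH⟩ : ∃ H : ℕ → Matrix (Fin dy) (Fin du) ℝ,
      ∀ i, GK Ast Bst Cst K (i + 1) = Matrix.fromRows (H i) (K * H i) :=
    ⟨fun i => Cst * (Ast + Bst * K * Cst) ^ i * Bst, fun i => by simp [GK, Matrix.mul_assoc]⟩
  have h0 : GK Ast Bst Cst K 0 = Matrix.fromRows 0 1 := if_pos rfl
  set y : EuclideanSpace ℝ (Fin dy) :=
    ∑ i ∈ Finset.range n, Matrix.toEuclideanLin (H i) (u (n - (i + 1)))
  refine ⟨y, ?_⟩
  have hl (j : Fin dy) : conv (GK Ast Bst Cst K) u n (Sum.inl j) = y j := by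
    simp [conv, Finset.sum_range_succ', hH, h0, y, toEuclideanLin_fromRows_apply]
  have hr (j : Fin du) : conv (GK Ast Bst Cst K) u n (Sum.inr j) =
      (u n + Matrix.toEuclideanLin K y) j := by
    rw [map_sum]
    simp only [conv, Finset.sum_range_succ', hH, h0, toEuclideanLin_mul_apply, PiLp.add_apply,
      WithLp.ofLp_sum, Finset.sum_apply, toEuclideanLin_fromRows_apply, Sum.elim_inr, Nat.sub_zero]
    simp [Matrix.toLpLin_apply, add_comm]
  simp only [EuclideanSpace.norm_sq_eq, Fintype.sum_sum_type, hl, hr]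

theorem norm_sq_le_conv_GK {dx du dy : ℕ} (Ast : Matrix (Fin dx) (Fin dx) ℝ)
    (Bst : Matrix (Fin dx) (Fin du) ℝ) (Cst : Matrix (Fin dy) (Fin dx) ℝ)
    (K : Matrix (Fin du) (Fin dy) ℝ) (u : ℕ → EuclideanSpace ℝ (Fin du)) (n : ℕ) :
    (1 / 2) * min 1 ((opNorm K ^ 2)⁻¹) * ‖u n‖ ^ 2 ≤ ‖conv (GK Ast Bst Cst K) u n‖ ^ 2 := by
  obtain ⟨y, hy⟩ := exists_norm_sq_conv_GK Ast Bst Cst K u n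
  rw [hy]
  set w := u n + Matrix.toEuclideanLin K y
  set m := min 1 ((opNorm K ^ 2)⁻¹)
  have hm0 : 0 ≤ m := le_min zero_le_one (by positivity)
  have hm1 : m ≤ 1 := min_le_left _ _
  have hmk : m * opNorm K ^ 2 ≤ 1 :=
    (mul_le_mul_of_nonneg_right (min_le_right _ _) (sq_nonneg _)).trans inv_mul_le_one
  have hu : ‖u n‖ ≤ ‖w‖ + opNorm K * ‖y‖ := by
    calc ‖u n‖ = ‖w - Matrix.toEuclideanLin K y‖ := by simp [w]
      _ ≤ ‖w‖ + ‖Matrix.toEuclideanLin K y‖ := norm_sub_le _ _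
      _ ≤ _ := by gcongr; exact norm_toEuclideanLin_le_opNorm K y
  have husq : ‖u n‖ ^ 2 ≤ 2 * (‖w‖ ^ 2 + (opNorm K * ‖y‖) ^ 2) :=
    (pow_le_pow_left₀ (norm_nonneg _) hu 2).trans add_sq_le
  calc 1 / 2 * m * ‖u n‖ ^ 2
      ≤ 1 / 2 * m * (2 * (‖w‖ ^ 2 + (opNorm K * ‖y‖) ^ 2)) := by gcongr
    _ = m * opNorm K ^ 2 * ‖y‖ ^ 2 + m * ‖w‖ ^ 2 := by ring
    _ ≤ 1 * ‖y‖ ^ 2 + 1 * ‖w‖ ^ 2 := by gcongr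
    _ = _ := by ring

/-- If `‖A_K^i‖_op ≤ c·ρ^i` for some `c ≥ 1`, `ρ ∈ (0,1)`, where
`A_K = A⋆ + B⋆·K·C⋆`, then for every input sequence `u` of unit ℓ² norm, the series
`Σ_{n=0}^∞ ‖Σ_{i=0}^{n} G_K^[i] u_{n−i}‖₂²` converges with sum at least
`(1/4)·min {1, ‖K‖_op^{−2}}`; i.e. `κ(G_K) ≥ (1/4)·min {1, ‖K‖_op^{−2}}`. -/
theorem stmt9 {dx du dy : ℕ} (Ast : Matrix (Fin dx) (Fin dx) ℝ)
    (Bst : Matrix (Fin dx) (Fin du) ℝ) (Cst : Matrix (Fin dy) (Fin dx) ℝ)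
    (K : Matrix (Fin du) (Fin dy) ℝ) (hK : K ≠ 0)
    (c ρ : ℝ) (hc : 1 ≤ c) (hρ : ρ ∈ Set.Ioo (0 : ℝ) 1)
    (hdecay : ∀ i : ℕ, opNorm ((Ast + Bst * K * Cst) ^ i) ≤ c * ρ ^ i) :
    ∀ u : ℕ → EuclideanSpace ℝ (Fin du), HasSum (fun n => ‖u n‖ ^ 2) 1 →
      Summable (fun n : ℕ => ‖conv (GK Ast Bst Cst K) u n‖ ^ 2) ∧
        (1 / 4) * min 1 ((opNorm K ^ 2)⁻¹) ≤
          ∑' n : ℕ, ‖conv (GK Ast Bst Cst K) u n‖ ^ 2 := by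
  intro u hu
  obtain ⟨M, hM⟩ := GK_geometric_bound Ast Bst Cst K (zero_le_one.trans hc) hρ.1 hdecay
  have hsum := summable_norm_sq_conv hρ hM hu.summable
  refine ⟨hsum, ?_⟩
  have hle := hasSum_le (norm_sq_le_conv_GK Ast Bst Cst K u) (hu.mul_left _) hsum.hasSum
  have hm : 0 ≤ min 1 ((opNorm K ^ 2)⁻¹) := le_min zero_le_one (by positivity)
  linarith
end
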